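/- There exist absolute constants C and C′ such that for every squarefree positive integer q and every X ≥ 1, the number of GL₂(ℤ)-equivalence classes of irreducible integral binary cubic forms f(x,y) = ax³ + bx²y + cxy² + dy³ with 0 < |disc(f)| ≤ X and with q dividing disc(f) is at most C′ · C^{ω(q)} · max{X/q, X^{5/6}}. -/

import Mathlib

open Polynomial

noncomputable section

/-- An integral binary cubic form `a x³ + b x² y + c x y² + d y³`, recorded by its
coefficients `(a, b, c, d)`. -/
abbrev BinaryCubic := ℤ × ℤ × ℤ × ℤ

/-- Evaluation of a binary cubic form. -/
def evalBC (f : BinaryCubic) (x y : ℤ) : ℤ :=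
  f.1 * x ^ 3 + f.2.1 * x ^ 2 * y + f.2.2.1 * x * y ^ 2 + f.2.2.2 * y ^ 3

/-- The discriminant `b²c² − 4ac³ − 4b³d − 27a²d² + 18abcd` of a binary cubic form. -/
def discBC (f : BinaryCubic) : ℤ :=
  f.2.1 ^ 2 * f.2.2.1 ^ 2 - 4 * f.1 * f.2.2.1 ^ 3 - 4 * f.2.1 ^ 3 * f.2.2.2
    - 27 * f.1 ^ 2 * f.2.2.2 ^ 2 + 18 * f.1 * f.2.1 * f.2.2.1 * f.2.2.2

/-- The binary cubic form is irreducible over `ℚ`: its leading coefficient is nonzero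
(so that `y` is not a factor) and the dehomogenization `a X³ + b X² + c X + d` is
irreducible in `ℚ[X]`. -/
def IrreducibleBC (f : BinaryCubic) : Prop :=
  f.1 ≠ 0 ∧ Irreducible (C (f.1 : ℚ) * X ^ 3 + C (f.2.1 : ℚ) * X ^ 2
    + C (f.2.2.1 : ℚ) * X + C (f.2.2.2 : ℚ))

/-- `GL₂(ℤ)`-equivalence of binary cubic forms: `g` is obtained from `f` by a linear
substitution of the variables by a matrix `M` with `det M = ±1`, twisted by the inverse
of the determinant (note `(det M)⁻¹ = det M` here). -/
def EquivBC (f g : BinaryCubic) : Prop :=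
  ∃ M : Matrix (Fin 2) (Fin 2) ℤ, IsUnit M.det ∧
    ∀ x y : ℤ, evalBC f (M 0 0 * x + M 0 1 * y) (M 1 0 * x + M 1 1 * y)
      = M.det * evalBC g x y

/-- The condition on `f` in the count: irreducible, with `0 < |disc f| ≤ X` and
`q ∣ disc f`. -/
def CondBC (q : ℕ) (X : ℝ) (f : BinaryCubic) : Prop :=
  IrreducibleBC f ∧ 0 < |discBC f| ∧ (|discBC f| : ℝ) ≤ X ∧ (q : ℤ) ∣ discBC f

/-- The number of `GL₂(ℤ)`-equivalence classes of irreducible integral binary cubic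
forms with `0 < |disc| ≤ X` and `q ∣ disc`, counted as the number of distinct
equivalence classes `{g | CondBC q X g ∧ f ∼ g}`. -/
def NclassesBC (q : ℕ) (X : ℝ) : ℕ :=
  Nat.card {S : Set BinaryCubic |
    ∃ f : BinaryCubic, CondBC q X f ∧ S = {g | CondBC q X g ∧ EquivBC f g}}

theorem exists_form_pos (a b c d : ℝ) (e : ℝ) (ha : a ≠ 0) (he : 0 < e)
    (hD : e ^ 4 = b ^ 2 * c ^ 2 - 4 * a * c ^ 3 - 4 * b ^ 3 * d - 27 * a ^ 2 * d ^ 2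
      + 18 * a * b * c * d) :
    ∃ P Q R : ℝ, 0 < P ∧ 4 * P * R - Q ^ 2 = 4 ∧ ∀ x y : ℝ,
      (a * x ^ 3 + b * x ^ 2 * y + c * x * y ^ 2 + d * y ^ 3) ^ 2
        ≤ 2 * e ^ 2 * (P * x ^ 2 + Q * x * y + R * y ^ 2) ^ 3 := by
  have h3 : (√3 : ℝ) ^ 2 = 3 := Real.sq_sqrt (by norm_num)
  have h3p : (0 : ℝ) < √3 := by positivity
  set r := √3 with hr
  have key : ∀ x y : ℝ, 27 * e ^ 4 * (a * x ^ 3 + b * x ^ 2 * y + c * x * y ^ 2 + d * y ^ 3) ^ 2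
      ≤ 4 * ((b ^ 2 - 3 * a * c) * x ^ 2 + (b * c - 9 * a * d) * x * y
        + (c ^ 2 - 3 * b * d) * y ^ 2) ^ 3 := by
    intro x y
    rw [hD]
    have := sq_nonneg ((2 * b ^ 3 - 9 * a * b * c + 27 * a ^ 2 * d) * x ^ 3
      + 3 * (b ^ 2 * c - 6 * a * c ^ 2 + 9 * a * b * d) * x ^ 2 * y
      - 3 * (b * c ^ 2 - 6 * b ^ 2 * d + 9 * a * c * d) * x * y ^ 2
      - (2 * c ^ 3 - 9 * b * c * d + 27 * a * d ^ 2) * y ^ 3)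
    linarith
  have hP : 0 < b ^ 2 - 3 * a * c := by
    have h1 := key 1 0
    have h2 : 0 < 27 * e ^ 4 * a ^ 2 := by positivity
    have : 0 < (b ^ 2 - 3 * a * c) ^ 3 := by nlinarith
    exact (Odd.pow_pos_iff (by decide)).1 this
  refine ⟨2 / (r * e ^ 2) * (b ^ 2 - 3 * a * c), 2 / (r * e ^ 2) * (b * c - 9 * a * d),
    2 / (r * e ^ 2) * (c ^ 2 - 3 * b * d), by positivity, ?_, ?_⟩
  · have : 4 * (b ^ 2 - 3 * a * c) * (c ^ 2 - 3 * b * d) - (b * c - 9 * a * d) ^ 2 = r ^ 2 * e ^ 4 := by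
      rw [h3, hD]; ring
    field_simp
    linear_combination 4 * this
  · intro x y
    have := key x y
    set H := (b ^ 2 - 3 * a * c) * x ^ 2 + (b * c - 9 * a * d) * x * y
        + (c ^ 2 - 3 * b * d) * y ^ 2 with hH
    set f := (a * x ^ 3 + b * x ^ 2 * y + c * x * y ^ 2 + d * y ^ 3) ^ 2
    have hHp : 0 ≤ H ^ 3 := by
      have : 0 ≤ 27 * e ^ 4 * f := by positivity
      linarith
    have e1 : 2 * e ^ 2 * (2 / (r * e ^ 2) * (b ^ 2 - 3 * a * c) * x ^ 2
      + 2 / (r * e ^ 2) * (b * c - 9 * a * d) * x * y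
      + 2 / (r * e ^ 2) * (c ^ 2 - 3 * b * d) * y ^ 2) ^ 3 = 16 * H ^ 3 / (r * 3 * e ^ 4) := by
      rw [hH, ← h3]; field_simp
      ring
    rw [e1, le_div_iff₀ (by positivity)]
    have hr2 : r ≤ 2 := by nlinarith
    have hf : 0 ≤ f * e ^ 4 := by positivity
    nlinarith

theorem exists_real_root (a b c d : ℝ) (ha : a ≠ 0) :
    ∃ θ : ℝ, a * θ ^ 3 + b * θ ^ 2 + c * θ + d = 0 := by
  wlog hap : 0 < a generalizing a b c d
  · obtain ⟨θ, h⟩ := this (-a) (-b) (-c) (-d) (by simpa using ha)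
      (by rcases lt_or_gt_of_ne ha with h | h; · linarith
          · exact absurd h hap)
    exact ⟨θ, by linarith⟩
  set M := (|b| + |c| + |d|) / a + 1 with hM
  have hM1 : 1 ≤ M := by have : 0 ≤ (|b| + |c| + |d|) / a := by positivity
                         linarith
  have haM : a * M = |b| + |c| + |d| + a := by rw [hM]; field_simp
  have hM2 : M ≤ M ^ 2 := by nlinarith
  have hM21 : 1 ≤ M ^ 2 := by nlinarith
  have hb := abs_le.1 (le_refl |b|)
  have hc := abs_le.1 (le_refl |c|)
  have hd := abs_le.1 (le_refl |d|)
  have e : a * M ^ 3 = (|b| + |c| + |d| + a) * M ^ 2 := by rw [← haM]; ring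
  have h1 : 0 ≤ a * M ^ 3 + b * M ^ 2 + c * M + d := by
    rw [e]
    nlinarith [abs_nonneg c, abs_nonneg d]
  have h2 : a * (-M) ^ 3 + b * (-M) ^ 2 + c * (-M) + d ≤ 0 := by
    have : a * (-M) ^ 3 = - (a * M ^ 3) := by ring
    rw [this, e]
    nlinarith [abs_nonneg c, abs_nonneg d]
  have := intermediate_value_Icc (show -M ≤ M by linarith)
    (f := fun t : ℝ => a * t ^ 3 + b * t ^ 2 + c * t + d) (by fun_prop)
  obtain ⟨θ, _, h⟩ := this ⟨h2, h1⟩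
  exact ⟨θ, h⟩

set_option maxHeartbeats 400000 in
theorem exists_form_neg (a b c d : ℝ) (e : ℝ) (ha : a ≠ 0) (he : 0 < e)
    (hD : -e ^ 4 = b ^ 2 * c ^ 2 - 4 * a * c ^ 3 - 4 * b ^ 3 * d - 27 * a ^ 2 * d ^ 2
      + 18 * a * b * c * d) :
    ∃ P Q R : ℝ, 0 < P ∧ 4 * P * R - Q ^ 2 = 4 ∧ ∀ x y : ℝ,
      (a * x ^ 3 + b * x ^ 2 * y + c * x * y ^ 2 + d * y ^ 3) ^ 2
        ≤ 2 * e ^ 2 * (P * x ^ 2 + Q * x * y + R * y ^ 2) ^ 3 := by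
  wlog hap : 0 < a generalizing a b c d
  · obtain ⟨P, Q, R, h1, h2, h3⟩ := this (-a) (-b) (-c) (-d) (by simpa using ha)
      (by rw [hD]; ring)
      (by rcases lt_or_gt_of_ne ha with h | h; · linarith
          · exact absurd h hap)
    exact ⟨P, Q, R, h1, h2, fun x y => le_trans (le_of_eq (by ring)) (h3 x y)⟩
  obtain ⟨θ, hθ⟩ := exists_real_root a b c d ha
  obtain ⟨B, hB⟩ : ∃ B, B = b + a * θ := ⟨_, rfl⟩
  obtain ⟨C, hC⟩ : ∃ C, C = c + B * θ := ⟨_, rfl⟩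
  have hd : d = - C * θ := by rw [hC, hB]; linarith
  have hb : b = B - a * θ := by linarith
  have hc : c = C - B * θ := by linarith
  obtain ⟨m, hm⟩ : ∃ m, m = a * θ ^ 2 + B * θ + C := ⟨_, rfl⟩
  obtain ⟨δ, hδ⟩ : ∃ δ, δ = 4 * a * C - B ^ 2 := ⟨_, rfl⟩
  have hDm : e ^ 4 = δ * m ^ 2 := by
    rw [← neg_inj, hD, hm, hδ, hd, hb, hc]; ring
  have he4 : 0 < e ^ 4 := by positivity
  have hδp : 0 < δ := by
    by_contra h
    nlinarith [sq_nonneg m]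
  have hmp : 0 < m := by
    have h1 : 4 * a * m = (2 * a * θ + B) ^ 2 + δ := by rw [hm, hδ]; ring
    have : 0 < 4 * a * m := by rw [h1]; positivity
    exact pos_of_mul_pos_right this (by positivity)
  -- `r ^ 2 * δ = 2` and `4 * s * r * m = 2`
  obtain ⟨r, hr, hrδ⟩ : ∃ r : ℝ, 0 < r ∧ r ^ 2 * δ = 2 :=
    ⟨√(2 / δ), by positivity, by rw [Real.sq_sqrt (by positivity)]; field_simp⟩
  obtain ⟨s, hs⟩ : ∃ s : ℝ, s = 1 / (2 * r * m) := ⟨_, rfl⟩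
  have hsp : 0 < s := by rw [hs]; positivity
  have hsrm : 2 * s * r * m = 1 := by rw [hs]; field_simp
  have hsr : 1 ≤ 2 * e ^ 2 * (s * r ^ 2) := by
    have h1 : (2 * e ^ 2 * (s * r ^ 2)) ^ 2 = 2 := by
      calc (2 * e ^ 2 * (s * r ^ 2)) ^ 2 = 4 * e ^ 4 * s ^ 2 * r ^ 4 := by ring
        _ = (2 * s * r * m) ^ 2 * (r ^ 2 * δ) := by rw [hDm]; ring
        _ = 2 := by rw [hsrm, hrδ]; ring
    have h2 : 0 < 2 * e ^ 2 * (s * r ^ 2) := by positivity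
    nlinarith
  refine ⟨s + r * a, -2 * θ * s + r * B, s * θ ^ 2 + r * C, by positivity, ?_, ?_⟩
  · have : 4 * (s + r * a) * (s * θ ^ 2 + r * C) - (-2 * θ * s + r * B) ^ 2
        = r ^ 2 * δ + 2 * (2 * s * r * m) := by rw [hm, hδ]; ring
    rw [this, hrδ, hsrm]; norm_num
  · intro x y
    obtain ⟨L, hL⟩ : ∃ L, L = (x - θ * y) ^ 2 := ⟨_, rfl⟩
    obtain ⟨q, hq⟩ : ∃ q, q = a * x ^ 2 + B * x * y + C * y ^ 2 := ⟨_, rfl⟩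
    have hL0 : 0 ≤ L := by rw [hL]; positivity
    have hq0 : 0 ≤ q := by
      have : 4 * a * q = (2 * a * x + B * y) ^ 2 + δ * y ^ 2 := by rw [hq, hδ]; ring
      have : 0 ≤ 4 * a * q := by rw [this]; positivity
      exact nonneg_of_mul_nonneg_right this (by positivity)
    have e1 : (a * x ^ 3 + b * x ^ 2 * y + c * x * y ^ 2 + d * y ^ 3) ^ 2 = L * q ^ 2 := by
      rw [hL, hq, hb, hc, hd]; ring
    have e2 : (s + r * a) * x ^ 2 + (-2 * θ * s + r * B) * x * y + (s * θ ^ 2 + r * C) * y ^ 2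
        = s * L + r * q := by rw [hL, hq]; ring
    rw [e1, e2]
    have h4 : (s * L) * (r * q) ^ 2 ≤ (s * L + r * q) ^ 3 := by
      generalize hu : s * L = u
      generalize hv : r * q = v
      have hu0 : 0 ≤ u := by rw [← hu]; positivity
      have hv0 : 0 ≤ v := by rw [← hv]; positivity
      have : (u + v) ^ 3 = u * v ^ 2 + (u ^ 3 + 3 * u ^ 2 * v + 2 * u * v ^ 2 + v ^ 3) := by ring
      rw [this]
      exact le_add_of_nonneg_right (by positivity)
    calc L * q ^ 2 ≤ (2 * e ^ 2 * (s * r ^ 2)) * (L * q ^ 2) :=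
          le_mul_of_one_le_left (by positivity) hsr
      _ = 2 * e ^ 2 * ((s * L) * (r * q) ^ 2) := by ring
      _ ≤ _ := by gcongr

theorem reduced_form_le (P Q R A B C D u Y m n x y : ℝ) (hP : 0 < P) (hY : 0 < Y)
    (hdisc : 4 * P * R - Q ^ 2 = 4) (hm : m = -Q / (2 * P)) (hn : n = 1 / P)
    (hdetR : A * D - B * C = 1) (h3 : 3 ≤ 4 * Y ^ 2) (hre : |u| ≤ 1 / 2)
    (hα : u * (C * m + D) - Y * (C * n) = A * m + B)
    (hβ : u * (C * n) + Y * (C * m + D) = A * n) :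
    P * (D * x + -B * y) ^ 2 + Q * (D * x + -B * y) * (-C * x + A * y)
      + R * (-C * x + A * y) ^ 2 ≤ 2 * (x ^ 2 / Y + Y * y ^ 2) := by
  have hQ : Q = -2 * P * m := by rw [hm]; field_simp
  have hPn : P * n = 1 := by rw [hn]; field_simp
  have hR : R = P * (m ^ 2 + n ^ 2) := by
    have : 4 * P * R = 4 * P * (P * (m ^ 2 + n ^ 2)) := by
      have e : 4 * P * (P * (m ^ 2 + n ^ 2)) = Q ^ 2 + 4 * (P * n) ^ 2 := by rw [hQ]; ring
      rw [e, hPn]; linarith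
    exact mul_left_cancel₀ (by positivity) this
  have hnorm : Y * (P * ((C * m + D) ^ 2 + (C * n) ^ 2)) = 1 := by
    have : Y * ((C * m + D) ^ 2 + (C * n) ^ 2) = n * (A * D - B * C) := by
      linear_combination (C * m + D) * hβ - (C * n) * hα
    rw [hdetR] at this
    linear_combination P * this + hPn
  have hN : P * (D * x + -B * y) ^ 2 + Q * (D * x + -B * y) * (-C * x + A * y)
      + R * (-C * x + A * y) ^ 2
      = P * ((C * m + D) ^ 2 + (C * n) ^ 2) * ((x - u * y) ^ 2 + Y ^ 2 * y ^ 2) := by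
    have e : P * ((C * m + D) ^ 2 + (C * n) ^ 2) * ((x - u * y) ^ 2 + Y ^ 2 * y ^ 2)
        = P * (((C * m + D) * x - (u * (C * m + D) - Y * (C * n)) * y) ^ 2
          + ((C * n) * x - (u * (C * n) + Y * (C * m + D)) * y) ^ 2) := by ring
    rw [e, hα, hβ, hQ, hR]; ring
  have hinv : P * ((C * m + D) ^ 2 + (C * n) ^ 2) = 1 / Y := by
    field_simp; linarith
  rw [hN, hinv]
  have hu : u ^ 2 ≤ 1 / 4 := by
    calc u ^ 2 = |u| ^ 2 := (sq_abs u).symm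
      _ ≤ (1 / 2) ^ 2 := by gcongr
      _ = 1 / 4 := by norm_num
  have e2 : 2 * (x ^ 2 / Y + Y * y ^ 2) = 1 / Y * (2 * x ^ 2 + 2 * Y ^ 2 * y ^ 2) := by
    field_simp
  rw [e2]
  refine mul_le_mul_of_nonneg_left ?_ (by positivity)
  have h5 : u ^ 2 * y ^ 2 ≤ 1 / 4 * y ^ 2 := by gcongr
  have h6 : 3 * y ^ 2 ≤ 4 * Y ^ 2 * y ^ 2 := by gcongr
  linarith [sq_nonneg (x + u * y), sq_nonneg y]

open scoped MatrixGroups in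
/-- Gauss reduction of a positive definite real binary quadratic form of discriminant `-4`. -/
theorem exists_reduced_basis (P Q R : ℝ) (hP : 0 < P) (hdisc : 4 * P * R - Q ^ 2 = 4) :
    ∃ p q r s : ℤ, p * s - q * r = 1 ∧ ∃ Y : ℝ, 0 < Y ∧ 3 ≤ 4 * Y ^ 2 ∧ ∀ x y : ℝ,
      P * (p * x + q * y) ^ 2 + Q * (p * x + q * y) * (r * x + s * y) + R * (r * x + s * y) ^ 2
        ≤ 2 * (x ^ 2 / Y + Y * y ^ 2) := by
  let z : UpperHalfPlane := ⟨⟨-Q / (2 * P), 1 / P⟩, by simpa using hP⟩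
  obtain ⟨g, hg⟩ := ModularGroup.exists_smul_mem_fd z
  have h3 := ModularGroup.three_le_four_mul_im_sq_of_mem_fd hg
  have him := (g • z).im_pos
  have hre := hg.2
  have hdet : g 0 0 * g 1 1 - g 0 1 * g 1 0 = 1 := by
    have := g.det_coe
    rwa [Matrix.det_fin_two] at this
  refine ⟨g 1 1, -g 0 1, -g 1 0, g 0 0, by linarith, (g • z).im, him, h3, ?_⟩
  intro x y
  have hco := UpperHalfPlane.coe_specialLinearGroup_apply g z
  have hz1 : (z : ℂ).re = -Q / (2 * P) := rfl
  have hz2 : (z : ℂ).im = 1 / P := rfl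
  set w := g • z with hw
  have hwre : (w : ℂ).re = w.re := rfl
  have hwim : (w : ℂ).im = w.im := rfl
  have hdne : ((g 1 0 : ℂ) * z + (g 1 1 : ℂ)) ≠ 0 := by
    have := UpperHalfPlane.denom_ne_zero (g : GL (Fin 2) ℝ) z
    simpa [UpperHalfPlane.denom] using this
  have hmul : (w : ℂ) * ((g 1 0 : ℂ) * z + (g 1 1 : ℂ)) = (g 0 0 : ℂ) * z + (g 0 1 : ℂ) := by
    rw [hco]
    simp only [algebraMap_int_eq, eq_intCast, Complex.ofReal_intCast]
    exact div_mul_cancel₀ _ hdne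
  have hdetR : (g 0 0 : ℝ) * g 1 1 - g 0 1 * g 1 0 = 1 := by exact_mod_cast hdet
  have h1 := congrArg Complex.re hmul
  have h2 := congrArg Complex.im hmul
  simp only [Complex.mul_re, Complex.mul_im, Complex.add_re, Complex.add_im, Complex.intCast_re,
    Complex.intCast_im, hz1, hz2, hwre, hwim] at h1 h2
  push_cast
  exact reduced_form_le P Q R _ _ _ _ w.re w.im _ _ x y hP him hdisc rfl rfl hdetR h3 hre
    (by linarith) (by linarith)

theorem coeff_bounds (a b c d w u : ℝ) (hw : 0 ≤ w) (hu : 0 < u)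
    (h : ∀ x y : ℝ, (a * x ^ 3 + b * x ^ 2 * y + c * x * y ^ 2 + d * y ^ 3) ^ 2
      ≤ w ^ 2 * (x ^ 2 / u ^ 2 + u ^ 2 * y ^ 2) ^ 3) :
    |a| ≤ w / u ^ 3 ∧ |b| ≤ 4 * w / u ∧ |c| ≤ 4 * w * u ∧ |d| ≤ w * u ^ 3 := by
  have ha : |a| ≤ w / u ^ 3 := by
    refine abs_le_of_sq_le_sq ?_ (by positivity)
    have := h 1 0
    calc a ^ 2 ≤ _ := by simpa using this
      _ = _ := by field_simp
  have hd : |d| ≤ w * u ^ 3 := by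
    refine abs_le_of_sq_le_sq ?_ (by positivity)
    have := h 0 1
    calc d ^ 2 ≤ _ := by simpa using this
      _ = _ := by ring
  have key : ∀ y : ℝ, y ^ 2 = 1 →
      |a * u ^ 6 + b * u ^ 4 * y + c * u ^ 2 + d * y| ≤ 3 * w * u ^ 3 := by
    intro y hy
    refine abs_le_of_sq_le_sq ?_ (by positivity)
    have := h (u ^ 2) y
    have e : a * (u ^ 2) ^ 3 + b * (u ^ 2) ^ 2 * y + c * u ^ 2 * y ^ 2 + d * y ^ 3
        = a * u ^ 6 + b * u ^ 4 * y + c * u ^ 2 + d * y := by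
      rw [show y ^ 3 = y ^ 2 * y by ring, hy]; ring
    rw [e, hy] at this
    have e2 : w ^ 2 * ((u ^ 2) ^ 2 / u ^ 2 + u ^ 2 * 1) ^ 3 = 8 * w ^ 2 * u ^ 6 := by
      field_simp; ring
    rw [e2] at this
    have : 0 ≤ w ^ 2 * u ^ 6 := by positivity
    nlinarith
  have k1 := abs_le.1 (key 1 (by norm_num))
  have k2 := abs_le.1 (key (-1) (by norm_num))
  have ha' : |a * u ^ 6| ≤ w * u ^ 3 := by
    rw [abs_mul, abs_of_pos (by positivity : 0 < u ^ 6)]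
    calc |a| * u ^ 6 ≤ w / u ^ 3 * u ^ 6 := by gcongr
      _ = _ := by field_simp
  have ka := abs_le.1 ha'
  have kd := abs_le.1 hd
  refine ⟨ha, ?_, ?_, hd⟩
  · have : |b * u ^ 4| ≤ 4 * w * u ^ 3 := abs_le.2 ⟨by linarith, by linarith⟩
    rw [abs_mul, abs_of_pos (by positivity : 0 < u ^ 4)] at this
    rw [le_div_iff₀ hu]
    refine le_of_mul_le_mul_right ?_ (by positivity : 0 < u ^ 3)
    linarith
  · have : |c * u ^ 2| ≤ 4 * w * u ^ 3 := abs_le.2 ⟨by linarith, by linarith⟩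
    rw [abs_mul, abs_of_pos (by positivity : 0 < u ^ 2)] at this
    refine le_of_mul_le_mul_right ?_ (by positivity : 0 < u ^ 2)
    linarith

theorem card_quadratic_roots_prime_le (p : ℕ) (hp : p.Prime) (u v w : ℤ)
    (h : ¬ ((p : ℤ) ∣ u ∧ (p : ℤ) ∣ v)) :
    ((Finset.range p).filter (fun d : ℕ => (p : ℤ) ∣ u * d ^ 2 + v * d + w)).card ≤ 2 := by
  have : Fact p.Prime := ⟨hp⟩
  set P : (ZMod p)[X] := C (u : ZMod p) * X ^ 2 + C (v : ZMod p) * X + C (w : ZMod p) with hP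
  have hcoeff (U V W : ZMod p) : (C U * X ^ 2 + C V * X + C W).coeff 2 = U ∧
      (C U * X ^ 2 + C V * X + C W).coeff 1 = V := by
    constructor <;> simp [coeff_C]
  have hP0 : P ≠ 0 := by
    intro h0
    apply h
    have h2 : P.coeff 2 = u := (hcoeff _ _ _).1
    have h1 : P.coeff 1 = v := (hcoeff _ _ _).2
    rw [h0, coeff_zero] at h1 h2
    exact ⟨(ZMod.intCast_zmod_eq_zero_iff_dvd _ _).1 h2.symm,
      (ZMod.intCast_zmod_eq_zero_iff_dvd _ _).1 h1.symm⟩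
  calc _ ≤ P.roots.toFinset.card := by
        refine Finset.card_le_card_of_injOn (fun d : ℕ => (d : ZMod p)) ?_ ?_
        · intro d hd
          simp only [Finset.coe_filter, Finset.mem_range, Set.mem_ofPred_eq] at hd
          have := (ZMod.intCast_zmod_eq_zero_iff_dvd _ _).2 hd.2
          simp only [Finset.mem_coe, Multiset.mem_toFinset, mem_roots hP0, IsRoot.def]
          push_cast at this
          simpa [hP] using this
        · intro d hd e he hde
          simp only [Finset.coe_filter, Finset.mem_range, Set.mem_ofPred_eq] at hd he
          have := (ZMod.natCast_eq_natCast_iff' _ _ _).1 hde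
          rwa [Nat.mod_eq_of_lt hd.1, Nat.mod_eq_of_lt he.1] at this
    _ ≤ P.roots.card := Multiset.toFinset_card_le _
    _ ≤ P.natDegree := card_roots' _
    _ ≤ 2 := natDegree_quadratic_le

theorem dvd_quadratic_mod_iff (m d : ℕ) (u v w : ℤ) :
    (m : ℤ) ∣ u * ((d % m : ℕ) : ℤ) ^ 2 + v * ((d % m : ℕ) : ℤ) + w
      ↔ (m : ℤ) ∣ u * (d : ℤ) ^ 2 + v * d + w := by
  have h : ((d % m : ℕ) : ℤ) ≡ d [ZMOD m] := by
    push_cast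
    exact Int.mod_modEq _ _
  exact ((((h.pow 2).mul_left u).add (h.mul_left v)).add_right w).dvd_iff

theorem card_quadratic_roots_mul_le (m n : ℕ) (hm : 0 < m) (hn : 0 < n) (hmn : m.Coprime n)
    (u v w : ℤ) :
    ((Finset.range (m * n)).filter
        (fun d : ℕ => ((m * n : ℕ) : ℤ) ∣ u * d ^ 2 + v * d + w)).card
      ≤ ((Finset.range m).filter (fun d : ℕ => (m : ℤ) ∣ u * d ^ 2 + v * d + w)).card
        * ((Finset.range n).filter (fun d : ℕ => (n : ℤ) ∣ u * d ^ 2 + v * d + w)).card := by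
  rw [← Finset.card_product]
  refine Finset.card_le_card_of_injOn (fun d => (d % m, d % n)) ?_ ?_
  · intro d hd
    simp only [Finset.coe_filter, Finset.mem_range, Set.mem_ofPred_eq, Nat.cast_mul] at hd
    simp only [Finset.mem_coe, Finset.mem_product, Finset.mem_filter, Finset.mem_range,
      dvd_quadratic_mod_iff]
    exact ⟨⟨Nat.mod_lt _ hm, dvd_of_mul_right_dvd hd.2⟩,
      Nat.mod_lt _ hn, dvd_of_mul_left_dvd hd.2⟩
  · intro d hd e he hde
    simp only [Finset.coe_filter, Finset.mem_range, Set.mem_ofPred_eq] at hd he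
    simp only [Prod.mk.injEq] at hde
    have := (Nat.modEq_and_modEq_iff_modEq_mul hmn).1 hde
    exact this.eq_of_lt_of_lt hd.1 he.1

theorem card_quadratic_roots_le (q : ℕ) (hq : Squarefree q) (u v w : ℤ)
    (h : ∀ p : ℕ, p.Prime → p ∣ q → ¬ ((p : ℤ) ∣ u ∧ (p : ℤ) ∣ v)) :
    ((Finset.range q).filter (fun d : ℕ => (q : ℤ) ∣ u * d ^ 2 + v * d + w)).card
      ≤ 2 ^ q.primeFactors.card := by
  induction q using Nat.recOnPosPrimePosCoprime with
  | prime_pow p n hp hn =>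
    have hn1 : n = 1 := ((Nat.squarefree_pow_iff hp.ne_one hn.ne').1 hq).2
    subst hn1
    rw [pow_one] at h ⊢
    simpa [hp.primeFactors] using card_quadratic_roots_prime_le p hp u v w (h p hp dvd_rfl)
  | zero => simp
  | one => simp
  | coprime a b ha hb hab iha ihb =>
    have h1 := iha hq.of_mul_left (fun p hp hpa => h p hp (hpa.mul_right b))
    have h2 := ihb hq.of_mul_right (fun p hp hpa => h p hp (hpa.mul_left a))
    calc _ ≤ _ := card_quadratic_roots_mul_le a b (by omega) (by omega) hab u v w
      _ ≤ _ := Nat.mul_le_mul h1 h2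
      _ = _ := by rw [← pow_add, hab.primeFactors_mul,
                    Finset.card_union_of_disjoint hab.disjoint_primeFactors]

theorem card_modEq_le (D m : ℕ) (hm : 0 < m) (v : ℤ) :
    (((Finset.Icc (-D : ℤ) D).filter (fun x => x ≡ v [ZMOD m])).card : ℝ) ≤ 2 * D / m + 1 := by
  have hI : Finset.Icc (-D : ℤ) D = Finset.Ioc (-D - 1 : ℤ) D := by
    ext x; simp only [Finset.mem_Icc, Finset.mem_Ioc]; omega
  have h := Int.Ioc_filter_modEq_card (-D - 1 : ℤ) D (r := (m : ℤ)) (by exact_mod_cast hm) v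
  rw [← hI] at h
  set L := ⌊(((D : ℤ) : ℚ) - v) / ((m : ℤ) : ℚ)⌋ with hL
  set k := ⌊(((-D - 1 : ℤ) : ℚ) - v) / ((m : ℤ) : ℚ)⌋ with hk
  have hmQ : (0 : ℚ) < ((m : ℤ) : ℚ) := by exact_mod_cast hm
  have e1 := Int.floor_le ((((D : ℤ) : ℚ) - v) / ((m : ℤ) : ℚ))
  have e3 := Int.lt_floor_add_one ((((-D - 1 : ℤ) : ℚ) - v) / ((m : ℤ) : ℚ))
  rw [← hL, le_div_iff₀ hmQ] at e1
  rw [← hk, div_lt_iff₀ hmQ] at e3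
  have e1' : L * m ≤ D - v := by exact_mod_cast e1
  have e4 : (-D - 1 : ℤ) - v < (k + 1) * m := by exact_mod_cast e3
  have hmR : (0 : ℝ) < m := by exact_mod_cast hm
  have h' : (((Finset.Icc (-D : ℤ) D).filter (fun x => x ≡ v [ZMOD m])).card : ℝ)
      = ((max (L - k) 0 : ℤ) : ℝ) := by rw [← h]; simp
  rw [h', Int.cast_max]
  apply max_le
  · have e5 : (L - k - 1) * m ≤ 2 * D := by linarith
    have e6 : ((L - k - 1 : ℤ) : ℝ) * m ≤ 2 * D := by exact_mod_cast e5
    rw [← le_div_iff₀ hmR] at e6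
    push_cast at e6 ⊢
    linarith
  · simp only [Int.cast_zero]
    positivity

theorem card_dvd_quadratic_le (q : ℕ) (hq : Squarefree q) (u v w : ℤ)
    (h : ∀ p : ℕ, p.Prime → p ∣ q → ¬ ((p : ℤ) ∣ u ∧ (p : ℤ) ∣ v)) (D : ℕ) :
    (((Finset.Icc (-D : ℤ) D).filter (fun d => (q : ℤ) ∣ u * d ^ 2 + v * d + w)).card : ℝ)
      ≤ 2 ^ q.primeFactors.card * (2 * D / q + 1) := by
  have hq0 : 0 < q := Nat.pos_of_ne_zero hq.ne_zero
  set R := (Finset.range q).filter (fun d : ℕ => (q : ℤ) ∣ u * d ^ 2 + v * d + w) with hR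
  have hsub : (Finset.Icc (-D : ℤ) D).filter (fun d => (q : ℤ) ∣ u * d ^ 2 + v * d + w)
      ⊆ R.biUnion (fun r => (Finset.Icc (-D : ℤ) D).filter (fun x => x ≡ (r : ℤ) [ZMOD q])) := by
    intro d hd
    rw [Finset.mem_filter] at hd
    have hr : ((d % q).toNat : ℤ) = d % q :=
      Int.toNat_of_nonneg (Int.emod_nonneg _ (by exact_mod_cast hq0.ne'))
    have hmod : d ≡ ((d % q).toNat : ℤ) [ZMOD q] := by
      rw [hr]; exact (Int.mod_modEq _ _).symm
    rw [Finset.mem_biUnion]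
    refine ⟨(d % q).toNat, ?_, ?_⟩
    · rw [hR, Finset.mem_filter, Finset.mem_range]
      refine ⟨?_, ((((hmod.pow 2).mul_left u).add (hmod.mul_left v)).add_right w).dvd_iff.1 hd.2⟩
      have := Int.emod_lt_of_pos d (by exact_mod_cast hq0 : (0 : ℤ) < q)
      omega
    · exact Finset.mem_filter.2 ⟨hd.1, hmod⟩
  have hRc : (R.card : ℝ) ≤ 2 ^ q.primeFactors.card := by
    exact_mod_cast card_quadratic_roots_le q hq u v w h
  calc _ ≤ ((R.biUnion fun r =>
          (Finset.Icc (-D : ℤ) D).filter (fun x => x ≡ (r : ℤ) [ZMOD q])).card : ℝ) := by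
        exact_mod_cast Finset.card_le_card hsub
    _ ≤ ∑ r ∈ R, (((Finset.Icc (-D : ℤ) D).filter
          (fun x => x ≡ (r : ℤ) [ZMOD q])).card : ℝ) := by
        exact_mod_cast Finset.card_biUnion_le
    _ ≤ ∑ r ∈ R, (2 * D / q + 1 : ℝ) := Finset.sum_le_sum fun r _ => card_modEq_le D q hq0 r
    _ = R.card * (2 * D / q + 1) := by rw [Finset.sum_const, nsmul_eq_mul]
    _ ≤ _ := by gcongr

theorem card_dvd_le (B m : ℕ) (hm : 0 < m) :
    (((Finset.Icc (-B : ℤ) B).filter (fun b => (m : ℤ) ∣ b)).card : ℝ) ≤ 2 * B / m + 1 := by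
  simpa only [Int.modEq_zero_iff_dvd] using card_modEq_le B m hm 0

theorem card_ne_zero_dvd_le (A m : ℕ) (hm : 0 < m) :
    (((Finset.Icc (-A : ℤ) A).filter (fun a => a ≠ 0 ∧ (m : ℤ) ∣ a)).card : ℝ)
      ≤ 2 * A / m := by
  have h : (Finset.Icc (-A : ℤ) A).filter (fun a => a ≠ 0 ∧ (m : ℤ) ∣ a)
      = ((Finset.Icc (-A : ℤ) A).filter (fun a => (m : ℤ) ∣ a)).erase 0 := by
    ext a; simp only [Finset.mem_filter, Finset.mem_erase]; tauto
  have h0 : (0 : ℤ) ∈ (Finset.Icc (-A : ℤ) A).filter (fun a => (m : ℤ) ∣ a) := by simp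
  rw [h, Finset.card_erase_of_mem h0, Nat.cast_sub (Finset.card_pos.2 ⟨_, h0⟩)]
  have := card_dvd_le A m hm
  push_cast
  linarith

/-- Integral binary cubic forms in a box, with nonzero leading coefficient and discriminant
divisible by `q`. -/
def boxBC (q A B C D : ℕ) : Finset BinaryCubic :=
  (Finset.Icc (-A : ℤ) A ×ˢ Finset.Icc (-B : ℤ) B ×ˢ Finset.Icc (-C : ℤ) C
    ×ˢ Finset.Icc (-D : ℤ) D).filter (fun f => f.1 ≠ 0 ∧ (q : ℤ) ∣ discBC f)

theorem discBC_eq_quadratic (f : BinaryCubic) :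
    discBC f = (-27 * f.1 ^ 2) * f.2.2.2 ^ 2
      + (18 * f.1 * f.2.1 * f.2.2.1 - 4 * f.2.1 ^ 3) * f.2.2.2
      + (f.2.1 ^ 2 * f.2.2.1 ^ 2 - 4 * f.1 * f.2.2.1 ^ 3) := by
  unfold discBC; ring

theorem dvd_of_dvd_disc_coeffs {p : ℕ} (hp : p.Prime) (h6 : p.Coprime 6) {a b c : ℤ}
    (h1 : (p : ℤ) ∣ -27 * a ^ 2) (h2 : (p : ℤ) ∣ 18 * a * b * c - 4 * b ^ 3) :
    (p : ℤ) ∣ a ∧ (p : ℤ) ∣ b := by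
  have hpZ : Prime (p : ℤ) := Nat.prime_iff_prime_int.1 hp
  have h2' : IsCoprime (p : ℤ) 2 := by
    exact_mod_cast Nat.isCoprime_iff_coprime.2 (h6.coprime_dvd_right (by norm_num : 2 ∣ 6))
  have h3' : IsCoprime (p : ℤ) 3 := by
    exact_mod_cast Nat.isCoprime_iff_coprime.2 (h6.coprime_dvd_right (by norm_num : 3 ∣ 6))
  have ha : (p : ℤ) ∣ a := by
    have : (p : ℤ) ∣ 3 ^ 3 * a ^ 2 := by
      rw [show 3 ^ 3 * a ^ 2 = -(-27 * a ^ 2) by ring]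
      exact (dvd_neg (α := ℤ)).2 h1
    exact hpZ.dvd_of_dvd_pow ((h3'.pow_right (n := 3)).dvd_of_dvd_mul_left this)
  refine ⟨ha, ?_⟩
  have : (p : ℤ) ∣ 2 ^ 2 * b ^ 3 := by
    have h3 : (p : ℤ) ∣ 18 * a * b * c := ((ha.mul_left 18).mul_right b).mul_right c
    rw [show 2 ^ 2 * b ^ 3 = 18 * a * b * c - (18 * a * b * c - 4 * b ^ 3) by ring]
    exact dvd_sub h3 h2
  exact hpZ.dvd_of_dvd_pow ((h2'.pow_right (n := 2)).dvd_of_dvd_mul_left this)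

theorem card_boxBC_fiber_le (q g A B C D : ℕ) (hq : Squarefree q) (h6 : q.Coprime 6) (hg : g ∣ q) :
    (((boxBC q A B C D).filter (fun f => q.gcd (Int.gcd f.1 f.2.1) = g)).card : ℝ)
      ≤ (2 * C + 1) * (2 * A / g) * (2 * B / g + 1)
        * (2 ^ q.primeFactors.card * (2 * D * g / q + 1)) := by
  obtain ⟨m, rfl⟩ := hg
  have hg0 : 0 < g := Nat.pos_of_ne_zero (left_ne_zero_of_mul hq.ne_zero)
  have hm0 : 0 < m := Nat.pos_of_ne_zero (right_ne_zero_of_mul hq.ne_zero)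
  have hgm : g.Coprime m := Nat.coprime_of_squarefree_mul hq
  set E := (boxBC (g * m) A B C D).filter (fun f => (g * m).gcd (Int.gcd f.1 f.2.1) = g) with hE
  set T := ((Finset.Icc (-A : ℤ) A).filter (fun a => a ≠ 0 ∧ (g : ℤ) ∣ a)) ×ˢ
    ((Finset.Icc (-B : ℤ) B).filter (fun b => (g : ℤ) ∣ b)) ×ˢ Finset.Icc (-C : ℤ) C with hT
  have hmaps : ∀ f ∈ E, (f.1, f.2.1, f.2.2.1) ∈ T := by
    intro f hf
    simp only [hE, boxBC, Finset.mem_filter, Finset.mem_product] at hf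
    obtain ⟨⟨⟨hA, hB, hC, hD⟩, h0, hdvd⟩, hgcd⟩ := hf
    have hgd : g ∣ Int.gcd f.1 f.2.1 := hgcd ▸ Nat.gcd_dvd_right _ _
    have h1 : (g : ℤ) ∣ f.1 := (Int.natCast_dvd_natCast.2 hgd).trans (Int.gcd_dvd_left ..)
    have h2 : (g : ℤ) ∣ f.2.1 := (Int.natCast_dvd_natCast.2 hgd).trans (Int.gcd_dvd_right ..)
    simp only [hT, Finset.mem_filter, Finset.mem_product]
    exact ⟨⟨hA, h0, h1⟩, ⟨hB, h2⟩, hC⟩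
  have hfib : ∀ t ∈ T, ((E.filter (fun f => (f.1, f.2.1, f.2.2.1) = t)).card : ℝ)
      ≤ 2 ^ (g * m).primeFactors.card * (2 * D * g / (g * m : ℕ) + 1) := by
    rintro ⟨a, b, c⟩ -
    have e : (2 * D * g / (g * m : ℕ) : ℝ) = 2 * D / m := by
      push_cast; field_simp
    rw [e]
    rcases Finset.eq_empty_or_nonempty (E.filter (fun f => (f.1, f.2.1, f.2.2.1) = (a, b, c)))
      with hem | ⟨f₀, hf₀⟩
    · rw [hem, Finset.card_empty, Nat.cast_zero]; positivity
    have hgcd : (g * m).gcd (Int.gcd a b) = g := by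
      simp only [hE, Finset.mem_filter, Prod.mk.injEq] at hf₀
      obtain ⟨⟨-, h⟩, ha, hb, -⟩ := hf₀
      rwa [ha, hb] at h
    have hnp : ∀ p : ℕ, p.Prime → p ∣ m →
        ¬ ((p : ℤ) ∣ -27 * a ^ 2 ∧ (p : ℤ) ∣ 18 * a * b * c - 4 * b ^ 3) := by
      rintro p hp hpm ⟨h1, h2⟩
      obtain ⟨ha, hb⟩ := dvd_of_dvd_disc_coeffs hp
        (h6.coprime_dvd_left (hpm.mul_left g)) h1 h2
      have : p ∣ g := hgcd ▸ Nat.dvd_gcd (hpm.mul_left g) (Int.dvd_gcd ha hb)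
      exact hp.one_lt.ne' (Nat.dvd_one.1 (hgm ▸ Nat.dvd_gcd this hpm))
    calc _ ≤ (((Finset.Icc (-D : ℤ) D).filter (fun d => (m : ℤ) ∣ (-27 * a ^ 2) * d ^ 2
            + (18 * a * b * c - 4 * b ^ 3) * d + (b ^ 2 * c ^ 2 - 4 * a * c ^ 3))).card : ℝ) := by
          norm_cast
          refine Finset.card_le_card_of_injOn (fun f => f.2.2.2) ?_ ?_
          · rintro ⟨a', b', c', d'⟩ hf
            simp only [hE, boxBC, Finset.coe_filter, Finset.mem_filter, Finset.mem_product,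
              Set.mem_ofPred_eq, Prod.mk.injEq, discBC_eq_quadratic] at hf ⊢
            obtain ⟨⟨⟨⟨-, -, -, hD⟩, -, hdvd⟩, -⟩, rfl, rfl, rfl⟩ := hf
            refine ⟨hD, dvd_trans ?_ hdvd⟩
            push_cast
            exact dvd_mul_left _ _
          · rintro ⟨a', b', c', d'⟩ hf ⟨a'', b'', c'', d''⟩ hf' hd
            simp only [Finset.coe_filter, Set.mem_ofPred_eq, Prod.mk.injEq] at hf hf' hd
            simp [hf.2, hf'.2, hd]
      _ ≤ 2 ^ m.primeFactors.card * (2 * D / m + 1) :=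
          card_dvd_quadratic_le m hq.of_mul_right _ _ _ hnp D
      _ ≤ _ := by
          gcongr
          · norm_num
          · exact Nat.primeFactors_mono (dvd_mul_left _ _) hq.ne_zero
  have hTc : (T.card : ℝ) ≤ (2 * A / g) * ((2 * B / g + 1) * (2 * C + 1)) := by
    rw [hT, Finset.card_product, Finset.card_product]
    push_cast
    have hC : ((Finset.Icc (-C : ℤ) C).card : ℝ) = 2 * C + 1 := by
      have : (Finset.Icc (-C : ℤ) C).card = 2 * C + 1 := by rw [Int.card_Icc]; omega
      rw [this]; push_cast; ring
    rw [hC]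
    gcongr
    · exact card_ne_zero_dvd_le A g hg0
    · exact card_dvd_le B g hg0
  rw [Finset.card_eq_sum_card_fiberwise (t := T) (f := fun f : BinaryCubic => (f.1, f.2.1, f.2.2.1))
    hmaps]
  push_cast
  calc _ ≤ ∑ t ∈ T, (2 ^ (g * m).primeFactors.card * (2 * D * g / (g * m : ℕ) + 1) : ℝ) :=
        Finset.sum_le_sum hfib
    _ = T.card * (2 ^ (g * m).primeFactors.card * (2 * D * g / (g * m : ℕ) + 1) : ℝ) := by
        rw [Finset.sum_const, nsmul_eq_mul]
    _ ≤ (2 * A / g) * ((2 * B / g + 1) * (2 * C + 1)) *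
        (2 ^ (g * m).primeFactors.card * (2 * D * g / (g * m : ℕ) + 1) : ℝ) := by gcongr
    _ = _ := by push_cast; ring

theorem card_boxBC_le_of_coprime (q A B C D : ℕ) (hq : Squarefree q) (h6 : q.Coprime 6) :
    ((boxBC q A B C D).card : ℝ) ≤ 4 ^ q.primeFactors.card * ((2 * C + 1)
      * (8 * A * B * D / q + 4 * A * B + 4 * A * D / q + 2 * A)) := by
  have hq0 : (0 : ℝ) < q := by exact_mod_cast Nat.pos_of_ne_zero hq.ne_zero
  have hmaps : ∀ f ∈ boxBC q A B C D, q.gcd (Int.gcd f.1 f.2.1) ∈ q.divisors := fun f _ =>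
    Nat.mem_divisors.2 ⟨Nat.gcd_dvd_left _ _, hq.ne_zero⟩
  have hterm : ∀ g ∈ q.divisors,
      (((boxBC q A B C D).filter (fun f => q.gcd (Int.gcd f.1 f.2.1) = g)).card : ℝ)
        ≤ 2 ^ q.primeFactors.card * ((2 * C + 1)
          * (8 * A * B * D / q + 4 * A * B + 4 * A * D / q + 2 * A)) := by
    intro g hg
    have hg1 : (1 : ℝ) ≤ g := by exact_mod_cast Nat.pos_of_mem_divisors hg
    have hg0 : (0 : ℝ) < g := by linarith
    refine (card_boxBC_fiber_le q g A B C D hq h6 (Nat.dvd_of_mem_divisors hg)).trans ?_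
    have e : ((2 * C + 1) * (2 * A / g) * (2 * B / g + 1)
        * (2 ^ q.primeFactors.card * (2 * D * g / q + 1)) : ℝ)
        = 2 ^ q.primeFactors.card * ((2 * C + 1) * (8 * A * B * D / q / g + 4 * A * B / g / g
          + 4 * A * D / q + 2 * A / g)) := by field_simp; ring
    rw [e]
    refine mul_le_mul_of_nonneg_left (mul_le_mul_of_nonneg_left ?_ (by positivity)) (by positivity)
    have i1 : (8 * A * B * D / q / g : ℝ) ≤ 8 * A * B * D / q := div_le_self (by positivity) hg1
    have i2 : (4 * A * B / g / g : ℝ) ≤ 4 * A * B :=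
      (div_le_self (by positivity) hg1).trans (div_le_self (by positivity) hg1)
    have i3 : (2 * A / g : ℝ) ≤ 2 * A := div_le_self (by positivity) hg1
    linarith
  rw [Finset.card_eq_sum_card_fiberwise (t := q.divisors)
    (f := fun f : BinaryCubic => q.gcd (Int.gcd f.1 f.2.1)) hmaps]
  push_cast
  refine (Finset.sum_le_sum hterm).trans (le_of_eq ?_)
  have hdiv : q.divisors.card = 2 ^ q.primeFactors.card := by
    rw [Nat.card_divisors hq.ne_zero, ← Finset.prod_const]
    refine Finset.prod_congr rfl fun p hp => ?_
    rw [Nat.factorization_eq_one_of_squarefree hq (Nat.prime_of_mem_primeFactors hp)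
      (Nat.dvd_of_mem_primeFactors hp)]
  rw [Finset.sum_const, nsmul_eq_mul, hdiv, ← mul_assoc]
  push_cast
  rw [← mul_pow]
  norm_num

theorem card_boxBC_le (q A B C D : ℕ) (hq : Squarefree q) :
    ((boxBC q A B C D).card : ℝ) ≤ 4 ^ q.primeFactors.card * ((2 * C + 1)
      * (48 * A * B * D / q + 4 * A * B + 24 * A * D / q + 2 * A)) := by
  obtain ⟨m, hm⟩ := Nat.gcd_dvd_left q 6
  have hq0 := Nat.pos_of_ne_zero hq.ne_zero
  have hm0 : 0 < m := Nat.pos_of_ne_zero (by rintro rfl; exact hq0.ne' (by rw [hm, mul_zero]))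
  have hg6 : q.gcd 6 ≤ 6 := Nat.gcd_le_right _ (by norm_num)
  have hmq : m ∣ q := ⟨q.gcd 6, by rw [mul_comm]; exact hm⟩
  have hsqm := hq.squarefree_of_dvd hmq
  have hm6 : m.Coprime 6 := by
    have h1 : (q.gcd 6).Coprime m := Nat.coprime_of_squarefree_mul (hm ▸ hq)
    have h2 : m.gcd 6 ∣ q.gcd 6 := Nat.gcd_dvd_gcd_of_dvd_left _ hmq
    exact Nat.dvd_one.1 (h1 ▸ Nat.dvd_gcd h2 (Nat.gcd_dvd_left _ _))
  have hsub : boxBC q A B C D ⊆ boxBC m A B C D := by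
    intro f hf
    simp only [boxBC, Finset.mem_filter] at hf ⊢
    exact ⟨hf.1, hf.2.1, (Int.natCast_dvd_natCast.2 hmq).trans hf.2.2⟩
  have hqm : (q : ℝ) ≤ 6 * m := by
    have : q ≤ 6 * m := by
      calc q = q.gcd 6 * m := hm
        _ ≤ _ := Nat.mul_le_mul_right _ hg6
    exact_mod_cast this
  have hqR : (0 : ℝ) < q := by exact_mod_cast hq0
  have hmR : (0 : ℝ) < m := by exact_mod_cast hm0
  have hdiv (x : ℝ) (hx : 0 ≤ x) : x / m ≤ 6 * x / q := by
    rw [div_le_div_iff₀ hmR hqR]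
    nlinarith
  have h1 := hdiv (8 * A * B * D) (by positivity)
  have h2 := hdiv (4 * A * D) (by positivity)
  calc ((boxBC q A B C D).card : ℝ) ≤ (boxBC m A B C D).card := by
        exact_mod_cast Finset.card_le_card hsub
    _ ≤ _ := card_boxBC_le_of_coprime m A B C D hsqm hm6
    _ ≤ _ := by
      have h3 : m.primeFactors.card ≤ q.primeFactors.card :=
        Finset.card_le_card (Nat.primeFactors_mono hmq hq.ne_zero)
      refine mul_le_mul (pow_le_pow_right₀ (by norm_num) h3) ?_ (by positivity) (by positivity)
      refine mul_le_mul_of_nonneg_left ?_ (by positivity)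
      rw [show (6 * (8 * A * B * D) / q : ℝ) = 48 * A * B * D / q by ring] at h1
      rw [show (6 * (4 * A * D) / q : ℝ) = 24 * A * D / q by ring] at h2
      linarith

theorem card_boxBC_scaled_le (q n A B C D : ℕ) (hq : Squarefree q) (κ l : ℝ) (hκ : 1 ≤ κ)
    (hl : 1 ≤ l) (hA : (A : ℝ) ≤ κ * l / 8 ^ n) (hB : (B : ℝ) ≤ κ * l / 2 ^ n)
    (hC : (C : ℝ) ≤ κ * l * 2 ^ n) (hD : (D : ℝ) ≤ κ * l * 8 ^ n) :
    ((boxBC q A B C D).card : ℝ)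
      ≤ 4 ^ q.primeFactors.card * (144 * κ ^ 4 * (l ^ 4 / q + l ^ 3) * 2 ^ n) := by
  refine (card_boxBC_le q A B C D hq).trans ?_
  refine mul_le_mul_of_nonneg_left ?_ (by positivity)
  have hq0 : (1 : ℝ) ≤ q := by exact_mod_cast Nat.pos_of_ne_zero hq.ne_zero
  have ht : (1 : ℝ) ≤ 2 ^ n := one_le_pow₀ (by norm_num)
  have e8 : (8 : ℝ) ^ n = (2 ^ n) ^ 3 := by rw [← pow_mul, mul_comm, pow_mul]; norm_num
  rw [e8] at hA hD
  generalize (2 : ℝ) ^ n = t at *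
  have ht0 : 0 < t := by linarith
  have hs1 : 1 ≤ κ * l := one_le_mul_of_one_le_of_one_le hκ hl
  have hC' : (2 * C + 1 : ℝ) ≤ 3 * (κ * l * t) := by
    have := one_le_mul_of_one_le_of_one_le hs1 ht
    linarith
  obtain ⟨v, hv⟩ : ∃ v, v = κ * l := ⟨_, rfl⟩
  rw [← hv] at hA hB hC hD hs1 hC'
  have hv0 : 0 < v := by linarith
  calc ((2 * C + 1) * (48 * A * B * D / q + 4 * A * B + 24 * A * D / q + 2 * A) : ℝ)
      ≤ 3 * (v * t) * (48 * (v / t ^ 3) * (v / t) * (v * t ^ 3) / q + 4 * (v / t ^ 3) * (v / t)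
          + 24 * (v / t ^ 3) * (v * t ^ 3) / q + 2 * (v / t ^ 3)) := by gcongr
    _ = 144 * (v ^ 4 / q) + 12 * (v ^ 3 / t ^ 3) + 72 * (v ^ 3 / q) * t + 6 * (v ^ 2 / t ^ 2) := by
        field_simp; ring
    _ ≤ 144 * (v ^ 4 / q) * t + 12 * v ^ 3 * t + 72 * v ^ 3 * t + 6 * v ^ 3 * t := by
        have k0 : v ^ 3 ≤ v ^ 3 * t := le_mul_of_one_le_right (by positivity) ht
        have k1 : v ^ 3 / t ^ 3 ≤ v ^ 3 * t :=
          (div_le_self (by positivity) (one_le_pow₀ ht)).trans k0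
        have k2 : v ^ 2 / t ^ 2 ≤ v ^ 3 * t :=
          ((div_le_self (by positivity) (one_le_pow₀ ht)).trans
            (pow_le_pow_right₀ hs1 (by norm_num : 2 ≤ 3))).trans k0
        have k3 : v ^ 3 / q * t ≤ v ^ 3 * t := by
          gcongr; exact div_le_self (by positivity) hq0
        have k4 : v ^ 4 / q ≤ v ^ 4 / q * t := le_mul_of_one_le_right (by positivity) ht
        linarith
    _ ≤ 144 * (v ^ 4 / q) * t + 144 * (κ * v ^ 3) * t := by
        have k0 : v ^ 3 * t ≤ (κ * v ^ 3) * t := by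
          gcongr; exact le_mul_of_one_le_left (by positivity) hκ
        have : 0 ≤ v ^ 3 * t := by positivity
        linarith
    _ = _ := by rw [hv]; ring

/-- The transform of a binary cubic form under `x ↦ p x + q y`, `y ↦ r x + s y`. -/
def substBC (f : BinaryCubic) (p q r s : ℤ) : BinaryCubic :=
  (f.1 * p ^ 3 + f.2.1 * p ^ 2 * r + f.2.2.1 * p * r ^ 2 + f.2.2.2 * r ^ 3,
   3 * f.1 * p ^ 2 * q + f.2.1 * (p ^ 2 * s + 2 * p * q * r)
    + f.2.2.1 * (2 * p * r * s + q * r ^ 2) + 3 * f.2.2.2 * r ^ 2 * s,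
   3 * f.1 * p * q ^ 2 + f.2.1 * (2 * p * q * s + q ^ 2 * r)
    + f.2.2.1 * (p * s ^ 2 + 2 * q * r * s) + 3 * f.2.2.2 * r * s ^ 2,
   f.1 * q ^ 3 + f.2.1 * q ^ 2 * s + f.2.2.1 * q * s ^ 2 + f.2.2.2 * s ^ 3)

theorem evalBC_substBC (f : BinaryCubic) (p q r s x y : ℤ) :
    evalBC (substBC f p q r s) x y = evalBC f (p * x + q * y) (r * x + s * y) := by
  simp only [evalBC, substBC]; ring

theorem discBC_substBC (f : BinaryCubic) (p q r s : ℤ) :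
    discBC (substBC f p q r s) = (p * s - q * r) ^ 6 * discBC f := by
  simp only [discBC, substBC]; ring

theorem equivBC_substBC (f : BinaryCubic) {p q r s : ℤ} (h : p * s - q * r = 1) :
    EquivBC f (substBC f p q r s) := by
  have hdet : (!![p, q; r, s] : Matrix (Fin 2) (Fin 2) ℤ).det = 1 := by
    rw [Matrix.det_fin_two_of, h]
  refine ⟨!![p, q; r, s], by simp [hdet], fun x y => ?_⟩
  rw [hdet, one_mul, evalBC_substBC]
  simp

theorem EquivBC.trans {f g h : BinaryCubic} (hfg : EquivBC f g) (hgh : EquivBC g h) :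
    EquivBC f h := by
  obtain ⟨M, hM, h1⟩ := hfg
  obtain ⟨N, hN, h2⟩ := hgh
  refine ⟨M * N, by rw [Matrix.det_mul]; exact hM.mul hN, fun x y => ?_⟩
  rw [Matrix.det_mul, mul_assoc, ← h2, ← h1]
  simp only [Matrix.mul_apply, Fin.sum_univ_two]
  congr 1 <;> ring

theorem EquivBC.symm {f g : BinaryCubic} (hfg : EquivBC f g) : EquivBC g f := by
  obtain ⟨M, hM, h⟩ := hfg
  have hsq : M.det * M.det = 1 := by
    rcases Int.isUnit_iff.1 hM with h | h <;> simp [h]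
  have hdet := Matrix.det_fin_two M
  set e := M.det with he
  refine ⟨!![e * M 1 1, -e * M 0 1; -e * M 1 0, e * M 0 0], ?_, ?_⟩
  · rw [Matrix.det_fin_two_of]
    have : e * M 1 1 * (e * M 0 0) - -e * M 0 1 * (-e * M 1 0) = e * e * e := by
      rw [hdet]; ring
    rw [this, hsq, one_mul]; exact hM
  · intro x y
    have hd : (!![e * M 1 1, -e * M 0 1; -e * M 1 0, e * M 0 0] : Matrix (Fin 2) (Fin 2) ℤ).det
        = e := by
      rw [Matrix.det_fin_two_of]
      have : e * M 1 1 * (e * M 0 0) - -e * M 0 1 * (-e * M 1 0) = e * e * e := by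
        rw [hdet]; ring
      rw [this, hsq, one_mul]
    rw [hd]
    have h1 := h (e * M 1 1 * x + -e * M 0 1 * y) (-e * M 1 0 * x + e * M 0 0 * y)
    have e1 : M 0 0 * (e * M 1 1 * x + -e * M 0 1 * y)
        + M 0 1 * (-e * M 1 0 * x + e * M 0 0 * y) = x := by
      linear_combination (-e * x) * hdet + x * hsq
    have e2 : M 1 0 * (e * M 1 1 * x + -e * M 0 1 * y)
        + M 1 1 * (-e * M 1 0 * x + e * M 0 0 * y) = y := by
      linear_combination (-e * y) * hdet + y * hsq
    rw [e1, e2] at h1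
    simp only [Matrix.of_apply, Matrix.cons_val', Matrix.cons_val_zero, Matrix.cons_val_one,
      Matrix.cons_val_fin_one]
    rw [h1, ← mul_assoc, hsq, one_mul]

theorem IrreducibleBC.evalBC_ne_zero {f : BinaryCubic} (hf : IrreducibleBC f) {p r : ℤ}
    (hpr : p ≠ 0 ∨ r ≠ 0) : evalBC f p r ≠ 0 := by
  obtain ⟨ha, hirr⟩ := hf
  intro h0
  rcases eq_or_ne r 0 with rfl | hr
  · have hp : p ≠ 0 := by simpa using hpr
    have : f.1 * p ^ 3 = 0 := by simpa [evalBC] using h0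
    exact mul_ne_zero ha (pow_ne_zero 3 hp) this
  · have haQ : (f.1 : ℚ) ≠ 0 := by exact_mod_cast ha
    have hrQ : (r : ℚ) ≠ 0 := by exact_mod_cast hr
    have h1 := degree_eq_one_of_irreducible_of_root hirr (x := (p : ℚ) / r) (by
      have h0Q : ((evalBC f p r : ℤ) : ℚ) = 0 := by exact_mod_cast h0
      simp only [evalBC] at h0Q
      push_cast at h0Q
      simp only [IsRoot.def, eval_add, eval_mul, eval_C, eval_pow, eval_X]
      field_simp
      linarith)
    rw [degree_cubic haQ] at h1
    exact absurd h1 (by decide)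

theorem exists_form (a b c d e : ℝ) (ha : a ≠ 0) (he : 0 < e)
    (hD : e ^ 4 = |b ^ 2 * c ^ 2 - 4 * a * c ^ 3 - 4 * b ^ 3 * d - 27 * a ^ 2 * d ^ 2
      + 18 * a * b * c * d|) :
    ∃ P Q R : ℝ, 0 < P ∧ 4 * P * R - Q ^ 2 = 4 ∧ ∀ x y : ℝ,
      (a * x ^ 3 + b * x ^ 2 * y + c * x * y ^ 2 + d * y ^ 3) ^ 2
        ≤ 2 * e ^ 2 * (P * x ^ 2 + Q * x * y + R * y ^ 2) ^ 3 := by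
  rcases abs_choice (b ^ 2 * c ^ 2 - 4 * a * c ^ 3 - 4 * b ^ 3 * d - 27 * a ^ 2 * d ^ 2
      + 18 * a * b * c * d) with h | h
  · exact exists_form_pos a b c d e ha he (hD.trans h)
  · exact exists_form_neg a b c d e ha he (by rw [hD, h, neg_neg])

/-- Membership of a form in the box of shape `l (t⁻³, t⁻¹, t, t³)` with `t = 2 ^ n`. -/
def InScaledBox (κ l : ℝ) (n : ℕ) (f : BinaryCubic) : Prop :=
  |(f.1 : ℝ)| ≤ κ * l / 8 ^ n ∧ |(f.2.1 : ℝ)| ≤ κ * l / 2 ^ n ∧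
    |(f.2.2.1 : ℝ)| ≤ κ * l * 2 ^ n ∧ |(f.2.2.2 : ℝ)| ≤ κ * l * 8 ^ n

theorem exists_reduced (f : BinaryCubic) (l : ℝ) (hl : 0 < l) (hf : IrreducibleBC f)
    (hpos : 0 < |discBC f|) (hle : (|discBC f| : ℝ) ≤ l ^ 4) :
    ∃ g : BinaryCubic, ∃ n : ℕ, EquivBC f g ∧ discBC g = discBC f ∧ g.1 ≠ 0 ∧
      InScaledBox 32 l n g := by
  have hDpos : (0 : ℝ) < |(discBC f : ℝ)| := by exact_mod_cast hpos
  obtain ⟨e, he, he4⟩ : ∃ e : ℝ, 0 < e ∧ e ^ 4 = |(discBC f : ℝ)| :=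
    ⟨√√|(discBC f : ℝ)|, by positivity, by
      rw [show 4 = 2 * 2 from rfl, pow_mul, Real.sq_sqrt (by positivity),
        Real.sq_sqrt (by positivity)]⟩
  have hel : e ≤ l := le_of_pow_le_pow_left₀ (by norm_num : (4 : ℕ) ≠ 0) hl.le (he4.trans_le hle)
  obtain ⟨P, Q, R, hP, hdisc, hform⟩ := exists_form f.1 f.2.1 f.2.2.1 f.2.2.2 e
    (by exact_mod_cast hf.1) he (by rw [he4]; congr 1; unfold discBC; push_cast; ring)
  obtain ⟨p, q, r, s, hdet, Y, hY, h3, hN⟩ := exists_reduced_basis P Q R hP hdisc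
  obtain ⟨u, hu, rfl⟩ : ∃ u : ℝ, 0 < u ∧ u ^ 2 = Y :=
    ⟨√Y, by positivity, Real.sq_sqrt hY.le⟩
  have h2u : 1 ≤ 2 * u := by
    by_contra h
    have h1 : u < 1 / 2 := by linarith
    have : (u ^ 2) ^ 2 < ((1 / 2) ^ 2) ^ 2 := by gcongr
    linarith
  obtain ⟨n, hn1, hn2⟩ := exists_nat_pow_near h2u (one_lt_two)
  have hn3 : u ≤ 2 ^ n := by rw [pow_succ] at hn2; linarith
  have hn4 : (2 : ℝ) ^ n / 2 ≤ u := by linarith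
  set g := substBC f p q r s with hg
  have hbd := coeff_bounds g.1 g.2.1 g.2.2.1 g.2.2.2 (4 * e) u (by positivity) hu (by
    intro x y
    have h1 := hform (p * x + q * y) (r * x + s * y)
    have h2 := hN x y
    have h4 : (P * (p * x + q * y) ^ 2 + Q * (p * x + q * y) * (r * x + s * y)
        + R * (r * x + s * y) ^ 2) ^ 3 ≤ (2 * (x ^ 2 / u ^ 2 + u ^ 2 * y ^ 2)) ^ 3 :=
      (Odd.pow_le_pow (by decide)).2 h2
    calc _ = _ := by simp only [hg, substBC]; push_cast; ring
      _ ≤ _ := h1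
      _ ≤ 2 * e ^ 2 * (2 * (x ^ 2 / u ^ 2 + u ^ 2 * y ^ 2)) ^ 3 := by gcongr
      _ = _ := by ring)
  obtain ⟨k1, k2, k3, k4⟩ := hbd
  have e8 : (8 : ℝ) ^ n = (2 ^ n) ^ 3 := by rw [← pow_mul, mul_comm, pow_mul]; norm_num
  refine ⟨g, n, equivBC_substBC f hdet, by rw [hg, discBC_substBC, hdet]; ring, ?_, ?_⟩
  · have : g.1 = evalBC f p r := by simp only [hg, substBC, evalBC]
    rw [this]
    refine hf.evalBC_ne_zero ?_
    by_contra! h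
    rw [h.1, h.2] at hdet
    simp at hdet
  · unfold InScaledBox
    rw [e8]
    generalize (2 : ℝ) ^ n = t at *
    have ht : 0 < t := by linarith
    refine ⟨k1.trans ?_, k2.trans ?_, k3.trans ?_, k4.trans ?_⟩
    · calc 4 * e / u ^ 3 ≤ 4 * l / (t / 2) ^ 3 := by gcongr
        _ = _ := by field_simp; norm_num
    · calc 4 * (4 * e) / u ≤ 4 * (4 * l) / (t / 2) := by gcongr
        _ = _ := by field_simp; norm_num
    · calc 4 * (4 * e) * u ≤ 4 * (4 * l) * t := by gcongr
        _ ≤ _ := by nlinarith [mul_pos hl ht]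
    · calc 4 * e * u ^ 3 ≤ 4 * l * t ^ 3 := by gcongr
        _ ≤ _ := by nlinarith [mul_pos hl (pow_pos ht 3)]

theorem InScaledBox.shift {κ l : ℝ} {n : ℕ} {g : BinaryCubic} (hκ : 0 ≤ κ) (hl : 0 ≤ l)
    (hg : InScaledBox κ l n g) {s : ℕ} (hs : s ≤ 4 ^ n) :
    InScaledBox (6 * κ) l n (substBC g 1 s 0 1) := by
  obtain ⟨a, b, c, d⟩ := g
  obtain ⟨ha, hb, hc, hd⟩ := hg
  have hs' : (s : ℝ) ≤ 4 ^ n := by exact_mod_cast hs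
  have e8 : (8 : ℝ) ^ n = (2 ^ n) ^ 3 := by rw [← pow_mul, mul_comm, pow_mul]; norm_num
  have e4 : (4 : ℝ) ^ n = (2 ^ n) ^ 2 := by rw [← pow_mul, mul_comm, pow_mul]; norm_num
  have ht : (0 : ℝ) < 2 ^ n := by positivity
  have hs0 : (0 : ℝ) ≤ s := by positivity
  simp only [InScaledBox, substBC, e8] at ha hb hc hd ⊢
  rw [e4] at hs'
  push_cast
  generalize (2 : ℝ) ^ n = t at *
  generalize (s : ℝ) = σ at *
  obtain ⟨v, hv⟩ : ∃ v, v = κ * l := ⟨_, rfl⟩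
  have hv0 : 0 ≤ v := by rw [hv]; positivity
  rw [mul_assoc 6 κ l, ← hv]
  rw [← hv] at ha hb hc hd
  have i1 : |(a : ℝ) * σ| ≤ v / t := by
    rw [abs_mul, abs_of_nonneg hs0]
    calc |(a : ℝ)| * σ ≤ v / t ^ 3 * t ^ 2 := by gcongr
      _ = _ := by field_simp
  have i2 : |(a : ℝ) * σ ^ 2| ≤ v * t := by
    rw [abs_mul, abs_of_nonneg (pow_nonneg hs0 2)]
    calc |(a : ℝ)| * σ ^ 2 ≤ v / t ^ 3 * (t ^ 2) ^ 2 := by gcongr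
      _ = _ := by field_simp
  have i3 : |(a : ℝ) * σ ^ 3| ≤ v * t ^ 3 := by
    rw [abs_mul, abs_of_nonneg (pow_nonneg hs0 3)]
    calc |(a : ℝ)| * σ ^ 3 ≤ v / t ^ 3 * (t ^ 2) ^ 3 := by gcongr
      _ = _ := by field_simp
  have i4 : |(b : ℝ) * σ| ≤ v * t := by
    rw [abs_mul, abs_of_nonneg hs0]
    calc |(b : ℝ)| * σ ≤ v / t * t ^ 2 := by gcongr
      _ = _ := by field_simp
  have i5 : |(b : ℝ) * σ ^ 2| ≤ v * t ^ 3 := by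
    rw [abs_mul, abs_of_nonneg (pow_nonneg hs0 2)]
    calc |(b : ℝ)| * σ ^ 2 ≤ v / t * (t ^ 2) ^ 2 := by gcongr
      _ = _ := by field_simp
  have i6 : |(c : ℝ) * σ| ≤ v * t ^ 3 := by
    rw [abs_mul, abs_of_nonneg hs0]
    calc |(c : ℝ)| * σ ≤ v * t * t ^ 2 := by gcongr
      _ = _ := by ring
  have p1 : 0 ≤ v / t ^ 3 := by positivity
  have p2 : 0 ≤ v / t := by positivity
  have p3 : 0 ≤ v * t := by positivity
  have p4 : 0 ≤ v * t ^ 3 := by positivity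
  rw [mul_div_assoc, mul_div_assoc, mul_assoc 6 v, mul_assoc 6 v]
  simp only [abs_le] at *
  refine ⟨⟨?_, ?_⟩, ⟨?_, ?_⟩, ⟨?_, ?_⟩, ⟨?_, ?_⟩⟩ <;> linarith

theorem natAbs_le_floor {a : ℤ} {A : ℝ} (h : |(a : ℝ)| ≤ A) :
    a ∈ Finset.Icc (-(⌊A⌋₊ : ℤ)) ⌊A⌋₊ := by
  have h1 : a.natAbs ≤ ⌊A⌋₊ := by
    apply Nat.le_floor
    rw [Nat.cast_natAbs]
    exact_mod_cast h
  rw [Finset.mem_Icc]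
  omega

theorem natCard_le_of_geometric_fibers {α : Type*} (φ : α → ℕ) (c : ℝ) (hc : 0 ≤ c)
    (h : ∀ n, ∀ F : Finset α, (∀ x ∈ F, φ x = n) → (F.card : ℝ) ≤ c * (1 / 2) ^ n) :
    (Nat.card α : ℝ) ≤ 2 * c := by
  rcases finite_or_infinite α with hfin | hinf
  · have := Fintype.ofFinite α
    rw [Nat.card_eq_fintype_card, ← Finset.card_univ,
      Finset.card_eq_sum_card_image φ Finset.univ]
    push_cast
    calc _ ≤ ∑ n ∈ Finset.univ.image φ, c * (1 / 2 : ℝ) ^ n :=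
          Finset.sum_le_sum fun n _ => h n _ (fun x hx => (Finset.mem_filter.1 hx).2)
      _ = c * ∑ n ∈ Finset.univ.image φ, (1 / 2 : ℝ) ^ n := by rw [Finset.mul_sum]
      _ ≤ c * 2 := by
          gcongr
          exact (summable_geometric_two.sum_le_tsum _ (fun i _ => by positivity)).trans_eq
            tsum_geometric_two
      _ = _ := mul_comm _ _
  · rw [Nat.card_eq_zero_of_infinite, Nat.cast_zero]; positivity

theorem NclassesBC_le (q : ℕ) (hq : Squarefree q) (X l : ℝ) (hl : 1 ≤ l) (hX : X = l ^ 4) :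
    (NclassesBC q X : ℝ)
      ≤ 2 * (4 ^ q.primeFactors.card * (144 * 192 ^ 4 * (l ^ 4 / q + l ^ 3))) := by
  have hl0 : 0 < l := by linarith
  have hrep : ∀ S : {S : Set BinaryCubic | ∃ f : BinaryCubic, CondBC q X f ∧
      S = {g | CondBC q X g ∧ EquivBC f g}}, ∃ (f g : BinaryCubic) (n : ℕ),
      (S : Set BinaryCubic) = {g | CondBC q X g ∧ EquivBC f g} ∧ EquivBC f g ∧
      (q : ℤ) ∣ discBC g ∧ g.1 ≠ 0 ∧ InScaledBox 32 l n g := by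
    rintro ⟨S, f, ⟨hirr, hpos, hle, hdvd⟩, hS⟩
    obtain ⟨g, n, h1, h2, h3, h4⟩ := exists_reduced f l hl0 hirr hpos (hX ▸ hle)
    exact ⟨f, g, n, hS, h1, h2 ▸ hdvd, h3, h4⟩
  choose f g φ hS hfg hdvd hne hbox using hrep
  refine natCard_le_of_geometric_fibers φ _ (by positivity) fun n F hF => ?_
  set A := ⌊192 * l / 8 ^ n⌋₊
  set B := ⌊192 * l / 2 ^ n⌋₊
  set C := ⌊192 * l * 2 ^ n⌋₊
  set D := ⌊192 * l * 8 ^ n⌋₊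
  have hcard : F.card * 4 ^ n ≤ (boxBC q A B C D).card := by
    rw [← Finset.card_range (4 ^ n), ← Finset.card_product]
    refine Finset.card_le_card_of_injOn (fun x => substBC (g x.1) 1 x.2 0 1) ?_ ?_
    · rintro ⟨S, s⟩ hx
      simp only [Finset.coe_product, Set.mem_prod, Finset.mem_coe, Finset.mem_range] at hx
      have hb := (hF S hx.1 ▸ hbox S).shift (by norm_num) hl0.le hx.2.le
      rw [show (6 * 32 : ℝ) = 192 by norm_num] at hb
      obtain ⟨b1, b2, b3, b4⟩ := hb
      simp only [boxBC, Finset.coe_filter, Set.mem_ofPred_eq, Finset.mem_product]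
      refine ⟨⟨natAbs_le_floor b1, natAbs_le_floor b2, natAbs_le_floor b3, natAbs_le_floor b4⟩,
        ?_, ?_⟩
      · simpa [substBC] using hne S
      · rw [discBC_substBC]
        exact (hdvd S).mul_left _
    · rintro ⟨S, s⟩ - ⟨S', s'⟩ - heq
      simp only at heq
      have h1 : EquivBC (f S) (f S') :=
        ((hfg S).trans (equivBC_substBC _ (by ring))).trans
          (heq ▸ ((hfg S').trans (equivBC_substBC _ (by ring))).symm)
      have hSS : S = S' := by
        apply Subtype.ext
        rw [hS S, hS S']
        ext k
        exact and_congr_right fun _ => ⟨h1.symm.trans, h1.trans⟩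
      subst hSS
      have hb := congrArg (fun k : BinaryCubic => k.2.1) heq
      simp only [substBC] at hb
      have : (g S).1 * ((s : ℤ) - s') = 0 := by linarith
      have : (s : ℤ) - s' = 0 := (mul_eq_zero.1 this).resolve_left (hne S)
      have : s = s' := by omega
      rw [this]
  have hfl {x : ℝ} (hx : 0 ≤ x) : (⌊x⌋₊ : ℝ) ≤ x := Nat.floor_le hx
  have hbc := card_boxBC_scaled_le q n A B C D hq 192 l (by norm_num) hl
    (hfl (by positivity)) (hfl (by positivity)) (hfl (by positivity)) (hfl (by positivity))
  have hcardR : (F.card : ℝ) * 4 ^ n ≤ (boxBC q A B C D).card := by exact_mod_cast hcard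
  have h4 : (4 : ℝ) ^ n = 2 ^ n * 2 ^ n := by rw [← mul_pow]; norm_num
  have hfin := hcardR.trans hbc
  rw [one_div, inv_pow, ← div_eq_mul_inv, le_div_iff₀ (by positivity)]
  refine le_of_mul_le_mul_right ?_ (by positivity : (0 : ℝ) < 2 ^ n)
  rw [h4] at hfin
  linarith

/-- **Uniformity estimate for binary cubic forms with ramified discriminant**
(cf. Theorem 3.2 and its proof).  There are absolute constants `C`, `C'` such that for
every squarefree `q ≥ 1` and all `X ≥ 1`, the number of `GL₂(ℤ)`-classes of irreducible
integral binary cubic forms with `0 < |disc| ≤ X` and `q ∣ disc` is at most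
`C' · C^{ω(q)} · max (X/q) (X^{5/6})`. -/
theorem binary_cubic_uniformity :
    ∃ C C' : ℝ, 0 < C ∧ 0 < C' ∧ ∀ q : ℕ, Squarefree q → ∀ X : ℝ, 1 ≤ X →
      (NclassesBC q X : ℝ)
        ≤ C' * C ^ q.primeFactors.card * max (X / (q : ℝ)) (X ^ ((5 : ℝ) / 6)) := by
  refine ⟨4, 2 * (144 * 192 ^ 4 * 2), by norm_num, by norm_num, fun q hq X hX => ?_⟩
  have hX0 : 0 ≤ X := by linarith
  have hl : 1 ≤ X ^ ((1 : ℝ) / 4) := Real.one_le_rpow hX (by norm_num)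
  have hl4 : (X ^ ((1 : ℝ) / 4)) ^ 4 = X := by
    rw [← Real.rpow_natCast, ← Real.rpow_mul hX0]; norm_num
  have hl3 : (X ^ ((1 : ℝ) / 4)) ^ 3 ≤ X ^ ((5 : ℝ) / 6) := by
    rw [← Real.rpow_natCast, ← Real.rpow_mul hX0]
    exact Real.rpow_le_rpow_of_exponent_le hX (by norm_num)
  refine (NclassesBC_le q hq X _ hl hl4.symm).trans ?_
  rw [hl4]
  have hmax : X / q + (X ^ ((1 : ℝ) / 4)) ^ 3 ≤ 2 * max (X / (q : ℝ)) (X ^ ((5 : ℝ) / 6)) := by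
    linarith [le_max_left (X / (q : ℝ)) (X ^ ((5 : ℝ) / 6)),
      le_max_right (X / (q : ℝ)) (X ^ ((5 : ℝ) / 6))]
  calc _ ≤ 2 * (4 ^ q.primeFactors.card * (144 * 192 ^ 4
        * (2 * max (X / (q : ℝ)) (X ^ ((5 : ℝ) / 6))))) := by gcongr
    _ = _ := by ring
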